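/- Let N ≥ 1 and let v, σ ∈ C²(ℝ^N) be functions such that v > 0 everywhere on ℝ^N, the differential inequality −div(v² ∇σ) ≤ 0 holds on ℝ^N, and there exists a constant C > 0 such that ∫_{B_R(0)} (v σ⁺)² dx ≤ C R² for all sufficiently large R. Then v² |∇σ⁺|² is integrable on ℝ^N, i.e. v² |∇σ⁺|² ∈ L¹(ℝ^N). -/

import Mathlib

open MeasureTheory Metric Filter

/-- The divergence of a vector field `F : ℝᴺ → ℝᴺ`, as the sum of the partial
derivatives of its components. -/
noncomputable def dvg {N : ℕ} (F : EuclideanSpace ℝ (Fin N) → EuclideanSpace ℝ (Fin N))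
    (x : EuclideanSpace ℝ (Fin N)) : ℝ :=
  ∑ i, fderiv ℝ (fun y => F y i) x (EuclideanSpace.single i 1)

/-- Cutoff nonlinearity, the derivative of the truncation. -/
noncomputable def kfun (m : ℝ) (s : ℝ) : ℝ := min 1 (m * max s 0)

/-- Smoothed positive part. -/
noncomputable def gfun (m : ℝ) (s : ℝ) : ℝ := ∫ t in (0:ℝ)..s, kfun m t

lemma kfun_cont (m : ℝ) : Continuous (kfun m) := by unfold kfun; fun_prop

lemma kfun_nonneg {m : ℝ} (hm : 0 ≤ m) (s : ℝ) : 0 ≤ kfun m s := by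
  unfold kfun; positivity

lemma kfun_le_one (m s : ℝ) : kfun m s ≤ 1 := min_le_left _ _

lemma kfun_mono {m : ℝ} (hm : 0 ≤ m) {s t : ℝ} (h : s ≤ t) : kfun m s ≤ kfun m t := by
  unfold kfun; gcongr

lemma gfun_deriv (m s : ℝ) : HasDerivAt (gfun m) (kfun m s) s :=
  ((kfun_cont m).integral_hasStrictDerivAt 0 s).hasDerivAt

lemma gfun_contDiff (m : ℝ) : ContDiff ℝ 1 (gfun m) := by
  rw [contDiff_one_iff_deriv]
  refine ⟨fun s => (gfun_deriv m s).differentiableAt, ?_⟩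
  have : deriv (gfun m) = kfun m := funext fun s => (gfun_deriv m s).deriv
  rw [this]; exact kfun_cont m

lemma gfun_of_nonpos (m : ℝ) {s : ℝ} (hs : s ≤ 0) : gfun m s = 0 := by
  unfold gfun
  rw [intervalIntegral.integral_congr (g := fun _ => (0:ℝ))]
  · simp
  · intro t ht
    rw [Set.uIcc_of_ge hs] at ht
    simp [kfun, max_eq_right ht.2]

lemma gfun_nonneg {m : ℝ} (hm : 0 ≤ m) (s : ℝ) : 0 ≤ gfun m s := by
  rcases le_total s 0 with hs | hs
  · rw [gfun_of_nonpos m hs]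
  · exact intervalIntegral.integral_nonneg hs fun t _ => kfun_nonneg hm t

lemma gfun_le {m : ℝ} (hm : 0 ≤ m) (s : ℝ) : gfun m s ≤ max s 0 * kfun m s := by
  rcases le_total s 0 with hs | hs
  · rw [gfun_of_nonpos m hs, max_eq_right hs]; simp
  · have := intervalIntegral.integral_mono_on (μ := volume) (f := kfun m)
      (g := fun _ => kfun m s) hs
      ((kfun_cont m).intervalIntegrable _ _) (by simp) (fun t ht => kfun_mono hm ht.2)
    rw [max_eq_left hs]
    simpa [gfun] using this

lemma gradient_pos_part {N : ℕ} (σ : EuclideanSpace ℝ (Fin N) → ℝ) (hσ : Continuous σ)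
    (x : EuclideanSpace ℝ (Fin N)) :
    gradient (fun y => max (σ y) 0) x = if 0 < σ x then gradient σ x else 0 := by
  split_ifs with h
  · have : (fun y => max (σ y) 0) =ᶠ[nhds x] σ := by
      filter_upwards [hσ.continuousAt.eventually (lt_mem_nhds h)] with y hy
      exact max_eq_left hy.le
    unfold gradient
    rw [this.fderiv_eq]
  · have : IsLocalMin (fun y => max (σ y) 0) x := by
      refine Eventually.of_forall fun y => ?_
      simp only [max_eq_right (not_lt.1 h)]
      exact le_max_right _ _
    unfold gradient
    rw [this.fderiv_eq_zero]; simp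

lemma pointwise_ineq {V a k G s d e p : ℝ} (hV : 0 ≤ V) (hk : 0 ≤ k) (hk1 : k ≤ 1)
    (hG : 0 ≤ G) (hGs : G ≤ s * k) (hs : 0 ≤ s) (hd : 0 ≤ d) (he : 0 ≤ e) (hp : |p| ≤ d * e) :
    V * (a ^ 2 * k * e ^ 2) ≤
      4 * (V * s ^ 2 * d ^ 2) + 2 * (V * (2 * a * G * p + a ^ 2 * k * e ^ 2)) := by
  have h1 : -(a * G * p) ≤ |a| * (s * k) * (d * e) := by
    calc -(a * G * p) ≤ |a * G * p| := neg_le_abs _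
      _ = |a| * G * |p| := by rw [abs_mul, abs_mul, abs_of_nonneg hG]
      _ ≤ _ := by gcongr
  have h2 : 0 ≤ k * (|a| * e - 2 * (s * d)) ^ 2 := by positivity
  have h3 : k * (s ^ 2 * d ^ 2) ≤ 1 * (s ^ 2 * d ^ 2) := by gcongr
  have h4 : |a| ^ 2 = a ^ 2 := sq_abs a
  have key : a ^ 2 * k * e ^ 2 ≤ 4 * (s ^ 2 * d ^ 2) + 2 * (2 * a * G * p + a ^ 2 * k * e ^ 2) := by
    have : k * (|a| * e - 2 * (s * d)) ^ 2
      = a ^ 2 * k * e ^ 2 - 4 * (|a| * (s * k) * (d * e)) + 4 * (k * (s ^ 2 * d ^ 2)) := by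
      rw [← h4]; ring
    linarith
  nlinarith [mul_le_mul_of_nonneg_left key hV]

lemma gradient_contDiff {N : ℕ} {σ : EuclideanSpace ℝ (Fin N) → ℝ} (hσ : ContDiff ℝ 2 σ) :
    ContDiff ℝ 1 (gradient σ) := by
  have h : ContDiff ℝ 1 (fderiv ℝ σ) := hσ.fderiv_right (by norm_num)
  exact (InnerProductSpace.toDual ℝ (EuclideanSpace ℝ (Fin N))).symm.contDiff.comp h

lemma int_by_parts {N : ℕ} (F : EuclideanSpace ℝ (Fin N) → EuclideanSpace ℝ (Fin N))
    (hF : ContDiff ℝ 1 F) (ψ : EuclideanSpace ℝ (Fin N) → ℝ) (hψ : ContDiff ℝ 1 ψ)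
    (hc : HasCompactSupport ψ) :
    ∫ x, fderiv ℝ ψ x (F x) = - ∫ x, ψ x * dvg F x := by
  have hFi : ∀ i, ContDiff ℝ 1 (fun y => F y i) := fun i => by fun_prop
  have hdψ : ∀ w, Continuous fun x => fderiv ℝ ψ x w := fun w =>
    (hψ.continuous_fderiv (by norm_num)).clm_apply continuous_const
  have hdF : ∀ i w, Continuous fun x => fderiv ℝ (fun y => F y i) x w := fun i w =>
    ((hFi i).continuous_fderiv (by norm_num)).clm_apply continuous_const
  have i1 : ∀ i, Integrable (fun x => fderiv ℝ ψ x (EuclideanSpace.single i 1) * F x i) :=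
    fun i => ((hdψ _).mul (hFi i).continuous).integrable_of_hasCompactSupport
      ((hc.fderiv_apply (𝕜 := ℝ) _).mul_right)
  have i2 : ∀ i, Integrable (fun x => ψ x *
      fderiv ℝ (fun y => F y i) x (EuclideanSpace.single i 1)) :=
    fun i => (hψ.continuous.mul (hdF i _)).integrable_of_hasCompactSupport hc.mul_right
  have i3 : ∀ i, Integrable (fun x => ψ x * F x i) :=
    fun i => (hψ.continuous.mul (hFi i).continuous).integrable_of_hasCompactSupport hc.mul_right
  have e1 : ∀ x, fderiv ℝ ψ x (F x)
      = ∑ i, fderiv ℝ ψ x (EuclideanSpace.single i 1) * F x i := by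
    intro x
    have : F x = ∑ i, F x i • EuclideanSpace.single i (1:ℝ) := by
      have := (EuclideanSpace.basisFun (Fin N) ℝ).sum_repr (F x)
      simpa using this.symm
    conv_lhs => rw [this]
    simp [mul_comm]
  simp only [e1, dvg, Finset.mul_sum]
  rw [integral_finsetSum _ fun i _ => i1 i, integral_finsetSum _ fun i _ => i2 i,
    ← Finset.sum_neg_distrib]
  refine Finset.sum_congr rfl fun i _ => ?_
  rw [integral_mul_fderiv_eq_neg_fderiv_mul_of_integrable (i1 i) (i2 i) (i3 i)
    (fun x _ => (hψ.differentiable (by norm_num)).differentiableAt)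
    (fun x _ => ((hFi i).differentiable (by norm_num)).differentiableAt), neg_neg]

lemma caccioppoli {N : ℕ} (v σ : EuclideanSpace ℝ (Fin N) → ℝ)
    (hv : ContDiff ℝ 2 v) (hσ : ContDiff ℝ 2 σ)
    (hineq : ∀ x, 0 ≤ dvg (fun y => (v y) ^ 2 • gradient σ y) x)
    (φ : EuclideanSpace ℝ (Fin N) → ℝ) (hφ : ContDiff ℝ 1 φ) (hc : HasCompactSupport φ)
    {m : ℝ} (hm : 0 ≤ m) :
    Integrable (fun x => (v x) ^ 2 * (φ x ^ 2 * kfun m (σ x) * ‖gradient σ x‖ ^ 2)) ∧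
    ∫ x, (v x) ^ 2 * (φ x ^ 2 * kfun m (σ x) * ‖gradient σ x‖ ^ 2) ≤
      4 * ∫ x, (v x) ^ 2 * (max (σ x) 0) ^ 2 * ‖fderiv ℝ φ x‖ ^ 2 := by
  have hg := gradient_contDiff hσ
  have hv1 : ContDiff ℝ 1 v := hv.of_le (by norm_num)
  have hσ1 : ContDiff ℝ 1 σ := hσ.of_le (by norm_num)
  have hF : ContDiff ℝ 1 (fun y => (v y) ^ 2 • gradient σ y) := (hv1.pow 2).smul hg
  have hG : ContDiff ℝ 1 (fun x => gfun m (σ x)) := (gfun_contDiff m).comp hσ1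
  have hψ : ContDiff ℝ 1 (fun x => φ x ^ 2 * gfun m (σ x)) := (hφ.pow 2).mul hG
  have hφ2 : HasCompactSupport (fun x => φ x ^ 2) := by
    have := hc.mul_right (f' := φ)
    simpa [pow_two, Pi.mul_def] using this
  have hψc : HasCompactSupport (fun x => φ x ^ 2 * gfun m (σ x)) := hφ2.mul_right
  have hibp := int_by_parts _ hF _ hψ hψc
  have hfd : ∀ x, fderiv ℝ (fun x => φ x ^ 2 * gfun m (σ x)) x ((v x) ^ 2 • gradient σ x)
      = (v x) ^ 2 * (2 * φ x * gfun m (σ x) * fderiv ℝ φ x (gradient σ x)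
        + φ x ^ 2 * kfun m (σ x) * ‖gradient σ x‖ ^ 2) := by
    intro x
    have h1 : HasFDerivAt φ (fderiv ℝ φ x) x := (hφ.differentiable (by norm_num) x).hasFDerivAt
    have h2 : HasFDerivAt σ (fderiv ℝ σ x) x := (hσ1.differentiable (by norm_num) x).hasFDerivAt
    have h3 := (gfun_deriv m (σ x)).comp_hasFDerivAt x h2
    have h4 := (h1.pow 2).mul h3
    have h5 : fderiv ℝ σ x (gradient σ x) = ‖gradient σ x‖ ^ 2 := by
      rw [← inner_gradient_left, real_inner_self_eq_norm_sq]
    have h6 : fderiv ℝ (fun x => φ x ^ 2 * gfun m (σ x)) x = _ := h4.fderiv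
    rw [h6]
    simp [h5]
    left
    ring
  have hneg : ∫ x, fderiv ℝ (fun x => φ x ^ 2 * gfun m (σ x)) x ((v x) ^ 2 • gradient σ x) ≤ 0 := by
    rw [hibp, neg_nonpos]
    exact integral_nonneg fun x =>
      mul_nonneg (mul_nonneg (sq_nonneg _) (gfun_nonneg hm _)) (hineq x)
  have hI0 : Integrable
      (fun x => fderiv ℝ (fun x => φ x ^ 2 * gfun m (σ x)) x ((v x) ^ 2 • gradient σ x)) := by
    refine Continuous.integrable_of_hasCompactSupport
      ((hψ.continuous_fderiv (by norm_num)).clm_apply hF.continuous) ?_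
    refine (hψc.fderiv (𝕜 := ℝ)).mono fun x hx => ?_
    contrapose! hx
    simp only [Function.mem_support, not_not] at hx ⊢
    rw [hx]; simp
  have hI1 : Integrable
      (fun x => (v x) ^ 2 * (φ x ^ 2 * kfun m (σ x) * ‖gradient σ x‖ ^ 2)) := by
    refine Continuous.integrable_of_hasCompactSupport ?_ ?_
    · have := kfun_cont m
      have h1 := hv.continuous
      have h2 := hφ.continuous
      have h3 := hσ.continuous
      have h4 := hg.continuous
      fun_prop
    · exact (hφ2.mul_right.mul_right).mul_left
  have hI2 : Integrable (fun x => (v x) ^ 2 * (max (σ x) 0) ^ 2 * ‖fderiv ℝ φ x‖ ^ 2) := by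
    refine Continuous.integrable_of_hasCompactSupport ?_ ?_
    · have h1 := hv.continuous
      have h2 := hφ.continuous_fderiv (by norm_num)
      have h3 := hσ.continuous
      fun_prop
    · refine (hc.fderiv (𝕜 := ℝ)).mono fun x hx => ?_
      contrapose! hx
      simp only [Function.mem_support, not_not] at hx ⊢
      rw [hx]; simp
  refine ⟨hI1, ?_⟩
  have hmono : ∫ x, (v x) ^ 2 * (φ x ^ 2 * kfun m (σ x) * ‖gradient σ x‖ ^ 2) ≤
      ∫ x, (4 * ((v x) ^ 2 * (max (σ x) 0) ^ 2 * ‖fderiv ℝ φ x‖ ^ 2) +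
        2 * fderiv ℝ (fun x => φ x ^ 2 * gfun m (σ x)) x ((v x) ^ 2 • gradient σ x)) := by
    refine integral_mono hI1 ((hI2.const_mul 4).add (hI0.const_mul 2)) fun x => ?_
    simp only [hfd]
    exact pointwise_ineq (sq_nonneg _) (kfun_nonneg hm _) (kfun_le_one _ _) (gfun_nonneg hm _)
      (gfun_le hm _) (le_max_right _ _) (norm_nonneg _) (norm_nonneg _)
      ((fderiv ℝ φ x).le_opNorm _)
  rw [integral_add (hI2.const_mul 4) (hI0.const_mul 2), integral_const_mul,
    integral_const_mul] at hmono
  linarith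

lemma exists_cutoff (N : ℕ) : ∃ K : ℝ, 0 ≤ K ∧ ∀ R : ℝ, 0 < R →
    ∃ φ : EuclideanSpace ℝ (Fin N) → ℝ, ContDiff ℝ 1 φ ∧ HasCompactSupport φ ∧
      (∀ x, ‖x‖ ≤ R → φ x = 1) ∧ (∀ x, ‖fderiv ℝ φ x‖ ≤ K / R) ∧
      (∀ x, 3 * R ≤ ‖x‖ → fderiv ℝ φ x = 0) := by
  let χ : ContDiffBump (0 : EuclideanSpace ℝ (Fin N)) := ⟨1, 2, one_pos, one_lt_two⟩
  have hχ : ContDiff ℝ 1 χ := χ.contDiff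
  obtain ⟨K, hK⟩ := (hχ.continuous_fderiv (by norm_num)).bounded_above_of_compact_support
    (χ.hasCompactSupport.fderiv (𝕜 := ℝ))
  refine ⟨K, (norm_nonneg _).trans (hK 0), fun R hR => ?_⟩
  have hfd : ∀ x, fderiv ℝ (fun x => χ (R⁻¹ • x)) x = R⁻¹ • fderiv ℝ χ (R⁻¹ • x) := by
    intro x
    have h1 : HasFDerivAt χ (fderiv ℝ χ (R⁻¹ • x)) (R⁻¹ • x) :=
      (hχ.differentiable (by norm_num) _).hasFDerivAt
    have h2 := h1.comp x ((hasFDerivAt_id x).const_smul R⁻¹)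
    have h3 : fderiv ℝ (fun x => χ (R⁻¹ • x)) x = _ := h2.fderiv
    rw [h3]; ext w; simp
  refine ⟨fun x => χ (R⁻¹ • x), hχ.comp (contDiff_const_smul _), ?_, ?_, ?_, ?_⟩
  · exact χ.hasCompactSupport.comp_smul (inv_ne_zero hR.ne')
  · intro x hx
    apply χ.one_of_mem_closedBall
    rw [mem_closedBall_zero_iff, norm_smul, norm_inv, Real.norm_of_nonneg hR.le, inv_mul_le_iff₀ hR]
    simpa [χ] using hx
  · intro x
    rw [hfd, norm_smul, norm_inv, Real.norm_of_nonneg hR.le, inv_mul_eq_div]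
    gcongr; exact hK _
  · intro x hx
    have : R⁻¹ • x ∉ tsupport χ := by
      rw [χ.tsupport_eq, mem_closedBall_zero_iff, norm_smul, norm_inv, Real.norm_of_nonneg hR.le,
        inv_mul_le_iff₀ hR]
      change ¬ (‖x‖ ≤ R * 2)
      linarith
    rw [hfd, image_eq_zero_of_notMem_tsupport (fun h => this (tsupport_fderiv_subset ℝ h)), smul_zero]

/-- Under the hypotheses of the Liouville-type theorem (Proposition 2.2):
`v, σ ∈ C²(ℝᴺ)`, `v > 0`, `-div(v² ∇σ) ≤ 0` on `ℝᴺ`, and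
`∫_{B_R(0)} (v σ⁺)² ≤ C R²` for all large `R`, one has `v² |∇σ⁺|² ∈ L¹(ℝᴺ)`. -/
theorem grad_sigma_plus_square_integrable
    (N : ℕ) (hN : 1 ≤ N) (v σ : EuclideanSpace ℝ (Fin N) → ℝ)
    (hv : ContDiff ℝ 2 v) (hσ : ContDiff ℝ 2 σ)
    (hvpos : ∀ x, 0 < v x)
    (hineq : ∀ x, 0 ≤ dvg (fun y => (v y) ^ 2 • gradient σ y) x)
    (C : ℝ) (hC : 0 < C)
    (hbound : ∀ᶠ R in atTop,
      ∫ x in ball (0 : EuclideanSpace ℝ (Fin N)) R, (v x * max (σ x) 0) ^ 2 ≤ C * R ^ 2) :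
    Integrable (fun x => (v x) ^ 2 * ‖gradient (fun y => max (σ y) 0) x‖ ^ 2) := by
  obtain ⟨K, hK0, hK⟩ := exists_cutoff N
  have hpos : ∀ n : ℕ, (0:ℝ) < (n:ℝ) + 1 := fun n => by positivity
  choose φ hφ hφc hφ1 hφK hφ0 using fun n : ℕ => hK ((n:ℝ) + 1) (hpos n)
  set f : ℕ → EuclideanSpace ℝ (Fin N) → ℝ := fun n x =>
    (v x) ^ 2 * (φ n x ^ 2 * kfun n (σ x) * ‖gradient σ x‖ ^ 2) with hf
  have hcac := fun n : ℕ =>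
    caccioppoli v σ hv hσ hineq (φ n) (hφ n) (hφc n) (m := (n:ℝ)) (Nat.cast_nonneg n)
  have hf0 : ∀ n x, 0 ≤ f n x := fun n x => by
    have := kfun_nonneg (Nat.cast_nonneg n) (σ x)
    simp only [hf]; positivity
  have hlim : ∀ x, Tendsto (fun n => f n x) atTop
      (nhds ((v x) ^ 2 * ‖gradient (fun y => max (σ y) 0) x‖ ^ 2)) := by
    intro x
    rw [gradient_pos_part σ hσ.continuous x]
    refine tendsto_const_nhds.congr' ?_
    split_ifs with h
    · filter_upwards [eventually_ge_atTop ⌈‖x‖⌉₊, eventually_ge_atTop ⌈1 / σ x⌉₊] with n h1 h2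
      have h1' : ‖x‖ ≤ n := Nat.ceil_le.1 h1
      have h2' : 1 / σ x ≤ n := Nat.ceil_le.1 h2
      have h3 : 1 ≤ n * σ x := (div_le_iff₀ h).1 h2'
      have h4 : kfun n (σ x) = 1 := by
        unfold kfun; rw [max_eq_left h.le]; exact min_eq_left h3
      simp only [hf, h4, hφ1 n x (by linarith)]
      ring
    · refine Eventually.of_forall fun n => ?_
      have h4 : kfun n (σ x) = 0 := by
        unfold kfun; rw [max_eq_right (not_lt.1 h)]; simp
      simp [hf, h4]
  have hbd : ∀ᶠ n : ℕ in atTop, ∫ x, f n x ≤ 36 * K ^ 2 * C := by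
    have ht : Tendsto (fun n : ℕ => 3 * ((n:ℝ) + 1)) atTop atTop :=
      (tendsto_atTop_add_const_right _ _ tendsto_natCast_atTop_atTop).const_mul_atTop (by norm_num)
    filter_upwards [ht.eventually hbound] with n hn
    have hp := hpos n
    have hcont : Continuous fun x => (v x * max (σ x) 0) ^ 2 := by
      have h1 := hv.continuous
      have h3 := hσ.continuous
      fun_prop
    have hint : IntegrableOn (fun x => (v x * max (σ x) 0) ^ 2)
        (ball (0 : EuclideanSpace ℝ (Fin N)) (3 * ((n:ℝ) + 1))) :=
      (hcont.continuousOn.integrableOn_compact (isCompact_closedBall _ _)).mono_set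
        ball_subset_closedBall
    have h1 : ∫ x, (v x) ^ 2 * (max (σ x) 0) ^ 2 * ‖fderiv ℝ (φ n) x‖ ^ 2 ≤
        (K / ((n:ℝ) + 1)) ^ 2 * ∫ x in ball (0 : EuclideanSpace ℝ (Fin N)) (3 * ((n:ℝ) + 1)),
          (v x * max (σ x) 0) ^ 2 := by
      rw [← integral_const_mul, ← integral_indicator measurableSet_ball]
      refine integral_mono_of_nonneg (Eventually.of_forall fun x => by positivity)
        ((integrable_indicator_iff measurableSet_ball).2 (hint.const_mul _))
        (Eventually.of_forall fun x => ?_)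
      by_cases hx : x ∈ ball (0 : EuclideanSpace ℝ (Fin N)) (3 * ((n:ℝ) + 1))
      · simp only [Set.indicator_of_mem hx]
        rw [mul_pow, mul_comm]
        gcongr
        exact hφK n x
      · simp only [Set.indicator_of_notMem hx]
        rw [hφ0 n x (by simpa using hx)]; simp
    calc ∫ x, f n x ≤ _ := (hcac n).2
      _ ≤ 4 * ((K / ((n:ℝ) + 1)) ^ 2 * (C * (3 * ((n:ℝ) + 1)) ^ 2)) := by
        gcongr
        exact h1.trans (by gcongr)
      _ = _ := by field_simp; ring
  refine ⟨aestronglyMeasurable_of_tendsto_ae atTop (fun n => (hcac n).1.aestronglyMeasurable)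
    (Eventually.of_forall hlim), ?_⟩
  rw [hasFiniteIntegral_iff_ofReal (Eventually.of_forall fun x => by positivity)]
  have hfat := lintegral_liminf_le' (μ := volume) (u := atTop)
    (f := fun n x => ENNReal.ofReal (f n x))
    (fun n => (hcac n).1.aestronglyMeasurable.aemeasurable.ennreal_ofReal)
  have e : ∀ x, liminf (fun n => ENNReal.ofReal (f n x)) atTop
      = ENNReal.ofReal ((v x) ^ 2 * ‖gradient (fun y => max (σ y) 0) x‖ ^ 2) :=
    fun x => (ENNReal.tendsto_ofReal (hlim x)).liminf_eq
  simp only [e] at hfat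
  refine hfat.trans_lt (lt_of_le_of_lt ?_ (ENNReal.ofReal_lt_top (r := 36 * K ^ 2 * C)))
  refine liminf_le_of_frequently_le' (Eventually.frequently ?_)
  filter_upwards [hbd] with n hn
  rw [← ofReal_integral_eq_lintegral_ofReal (hcac n).1 (Eventually.of_forall (hf0 n))]
  exact ENNReal.ofReal_le_ofReal hn
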